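/- arXiv:1909.13033 — 2 statements merged into one kernel-verified Lean document; each statement's English description precedes it below -/
import Mathlib

section
/- Let n, m ≥ 1, let W be an n×n real symmetric positive-definite matrix, D an n×n real symmetric matrix, A an n×n real matrix, B an n×m real matrix, Y an m×n real matrix, and λ > 0. If the matrix −D + A W + W Aᵀ − B Y − Yᵀ Bᵀ + 2λ W is negative semidefinite, then, setting M := W⁻¹, K := Y W⁻¹, and A_cl := A − B K, the matrix −M D M + M A_cl + A_clᵀ M + 2λ M is negative semidefinite. -/
open Matrix

/-- The algebraic content of the CCM synthesis step: the LMI (7)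
`-D + AW + WAᵀ - BY - YᵀBᵀ + 2λW ⪯ 0` implies, with `M = W⁻¹`, `K = YW⁻¹` and
`A_cl = A - BK`, the closed-loop contraction inequality (8)
`-MDM + M A_cl + A_clᵀ M + 2λM ⪯ 0`. -/
theorem ccm_lmi_congruence
    (n m : ℕ) (hn : 1 ≤ n) (hm : 1 ≤ m)
    (W D A : Matrix (Fin n) (Fin n) ℝ)
    (B : Matrix (Fin n) (Fin m) ℝ) (Y : Matrix (Fin m) (Fin n) ℝ)
    (lam : ℝ) (hlam : 0 < lam)
    (hW : W.PosDef) (hD : D.IsSymm)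
    (hLMI : (-(-D + A * W + W * Aᵀ - B * Y - Yᵀ * Bᵀ + (2 * lam) • W)).PosSemidef) :
    ∀ M K A_cl, M = W⁻¹ → K = Y * W⁻¹ → A_cl = A - B * K →
      (-(-(M * D * M) + M * A_cl + A_clᵀ * M + (2 * lam) • M)).PosSemidef := by
  rintro _ _ _ rfl rfl rfl
  have hdet : IsUnit W.det := (isUnit_iff_isUnit_det W).mp hW.isUnit
  have hsymm : (W⁻¹)ᵀ = W⁻¹ := by
    simpa only [conjTranspose_eq_transpose_of_trivial] using hW.inv.isHermitian.eq
  have hcongr := hLMI.mul_mul_conjTranspose_same W⁻¹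
  rw [conjTranspose_eq_transpose_of_trivial, hsymm] at hcongr
  convert hcongr using 1
  simp only [transpose_sub, transpose_mul, hsymm, mul_neg, neg_mul, mul_add, add_mul, mul_sub,
    sub_mul, Matrix.mul_smul, Matrix.smul_mul, Matrix.mul_assoc, mul_nonsing_inv W hdet,
    nonsing_inv_mul_cancel_left W _ hdet, Matrix.mul_one]
  abel
end

section
/- Let E : [0,∞) → ℝ be differentiable with E(t) ≥ 0 for all t, and let λ > 0, p ≥ 0, q ≥ 0 be constants such that for all t ≥ 0, (1/2) E′(t) ≤ −λ E(t) + p √(E(t)) + q. Let w* := (p + √(p² + 4λq)) / (2λ). Then for every ε > 0 there exists T ≥ 0 such that for all t ≥ T, √(E(t)) ≤ w* + ε. -/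
/-- A differentiable function that decreases at a uniform rate while it is at least `M` on
`[0, ∞)` is eventually at most `M`. -/
theorem exists_forall_ge_le_of_deriv_le_neg {f : ℝ → ℝ} (hf : Differentiable ℝ f) {M c : ℝ}
    (hc : 0 < c) (hdecr : ∀ t ≥ (0:ℝ), M ≤ f t → deriv f t ≤ -c) :
    ∃ T ≥ (0:ℝ), ∀ t ≥ T, f t ≤ M := by
  have hright : ∀ x, HasDerivWithinAt f (deriv f x) (Set.Ici x) x := fun x =>
    (hf x).hasDerivAt.hasDerivWithinAt
  obtain ⟨T, hT, hfT⟩ : ∃ T ≥ (0:ℝ), f T ≤ M := by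
    by_contra! habove
    have hlinear : ∀ t ≥ (0:ℝ), f t ≤ f 0 + -(c / 2) * t := fun t ht =>
      image_le_of_deriv_right_lt_deriv_boundary (a := 0) (b := t) hf.continuous.continuousOn
        (fun x _ => hright x) (B := fun x => f 0 + -(c / 2) * x) (B' := fun _ => -(c / 2))
        (by simp)
        (fun x => by simpa using ((hasDerivAt_id x).const_mul (-(c / 2))).const_add (f 0))
        (fun x hx _ => by linarith [hdecr x hx.1 (habove x hx.1).le])
        ⟨ht, le_rfl⟩
    have hpos : 0 ≤ (f 0 - M) / (c / 2) :=
      div_nonneg (by linarith [habove 0 le_rfl]) (by linarith)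
    have hcancel : c / 2 * ((f 0 - M) / (c / 2)) = f 0 - M := by field_simp
    linarith [habove _ hpos, hlinear _ hpos]
  refine ⟨T, hT, fun t ht => ?_⟩
  exact image_le_of_deriv_right_lt_deriv_boundary (a := T) (b := t) hf.continuous.continuousOn
    (fun x _ => hright x) (B := fun _ => M) (B' := fun _ => 0) hfT
    (fun x => hasDerivAt_const x M)
    (fun x hx hfx => by linarith [hdecr x (hT.trans hx.1) hfx.ge])
    ⟨ht, le_rfl⟩

/-- Differential-inequality argument behind Theorem 2 of the paper: if
`(1/2)E' ≤ -λE + p√E + q` with `E ≥ 0`, then `√E` is ultimately bounded by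
`w* = (p + √(p² + 4λq))/(2λ)`. -/
theorem ultimate_bound
    (E : ℝ → ℝ) (hE : Differentiable ℝ E) (hE_nonneg : ∀ t ≥ (0:ℝ), 0 ≤ E t)
    (lam p q : ℝ) (hlam : 0 < lam) (hp : 0 ≤ p) (hq : 0 ≤ q)
    (hineq : ∀ t ≥ (0:ℝ),
      (1 / 2) * deriv E t ≤ -lam * E t + p * Real.sqrt (E t) + q) :
    ∀ ε > (0:ℝ), ∃ T ≥ (0:ℝ), ∀ t ≥ T,
      Real.sqrt (E t) ≤ (p + Real.sqrt (p ^ 2 + 4 * lam * q)) / (2 * lam) + ε := by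
  intro ε hε
  set s := Real.sqrt (p ^ 2 + 4 * lam * q) with hs
  set w := (p + s) / (2 * lam) with hw
  have hs_nonneg : 0 ≤ s := Real.sqrt_nonneg _
  have hs_sq : s ^ 2 = p ^ 2 + 4 * lam * q := Real.sq_sqrt (by positivity)
  have hw_nonneg : 0 ≤ w := by positivity
  have hw_lin : 2 * lam * w = p + s := by rw [hw]; field_simp
  have hw_root : lam * w ^ 2 = p * w + q := by
    have : 4 * lam * (lam * w ^ 2 - p * w - q) = 0 := by
      linear_combination (2 * lam * w - p + s) * hw_lin + hs_sq
    have := (mul_eq_zero.mp this).resolve_left (by positivity)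
    linarith
  have hdecr : ∀ t ≥ (0:ℝ), (w + ε) ^ 2 ≤ E t → deriv E t ≤ -(2 * lam * ε ^ 2) := by
    intro t ht hle
    have hx : w + ε ≤ Real.sqrt (E t) := Real.le_sqrt_of_sq_le hle
    have hx_sq := Real.sq_sqrt (hE_nonneg t ht)
    obtain ⟨d, hd⟩ : ∃ d, Real.sqrt (E t) = w + d := ⟨Real.sqrt (E t) - w, by ring⟩
    have h := hineq t ht
    rw [← hx_sq, Real.sqrt_sq (Real.sqrt_nonneg _), hd] at h
    have hεd : ε ≤ d := by linarith
    have hsd : 0 ≤ s * d := mul_nonneg hs_nonneg (hε.le.trans hεd)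
    have hdd : lam * ε ^ 2 ≤ lam * d ^ 2 := by gcongr
    have hexpand : -lam * (w + d) ^ 2 + p * (w + d) + q = -(lam * d ^ 2) - s * d := by
      linear_combination -hw_root - d * hw_lin
    linarith
  obtain ⟨T, hT, hbound⟩ := exists_forall_ge_le_of_deriv_le_neg hE
    (show 0 < 2 * lam * ε ^ 2 by positivity) hdecr
  exact ⟨T, hT, fun t ht => Real.sqrt_le_iff.mpr ⟨by positivity, hbound t ht⟩⟩
end
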